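/- arXiv:2007.11491 — 5 statements merged into one kernel-verified Lean document; each statement's English description precedes it below -/
import Mathlib

section
/- Let G be a connected simple graph on a finite vertex set V, let H be a real matrix indexed by V × V with geodesic-width ω(H), and let P_H be the associated diagonal preconditioning matrix. Then HᵀH ⪯ P_H², i.e., the matrix P_H² − HᵀH is positive semidefinite. -/
open Matrix BigOperators Finset Filter

/-- The `s`-hop neighborhood `B(i,s) = {j : ρ(j,i) ≤ s}` of a vertex `i`,
where `ρ` is the geodesic distance on the graph `G`. -/
noncomputable def gBall {V : Type*} [Fintype V] (G : SimpleGraph V) (i : V) (s : ℕ) :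
    Finset V :=
  @Finset.filter V (fun j => G.dist j i ≤ s) (fun _ => Nat.decLe _ _) Finset.univ

lemma gBall_nonempty {V : Type*} [Fintype V] (G : SimpleGraph V) (i : V) (s : ℕ) :
    (gBall G i s).Nonempty :=
  ⟨i, by simp [gBall, SimpleGraph.dist_self]⟩

/-- The diagonal preconditioner `P_H` with diagonal entries
`P_H(i,i) = max_{k ∈ B(i,ω)} max( Σ_{j ∈ B(k,ω)} |H(j,k)|, Σ_{j ∈ B(k,ω)} |H(k,j)| )`. -/
noncomputable def precond {V : Type*} [Fintype V] [DecidableEq V] (G : SimpleGraph V)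
    (H : Matrix V V ℝ) (ω : ℕ) : Matrix V V ℝ :=
  Matrix.diagonal (fun i =>
    (gBall G i ω).sup' (gBall_nonempty G i ω) (fun k =>
      max (∑ j ∈ gBall G k ω, |H j k|) (∑ j ∈ gBall G k ω, |H k j|)))

/-- The symmetric diagonal preconditioner `P_H^sym` with diagonal entries
`P_H^sym(i,i) = Σ_{j ∈ B(i,ω)} |H(i,j)|`. -/
noncomputable def psym {V : Type*} [Fintype V] [DecidableEq V] (G : SimpleGraph V)
    (H : Matrix V V ℝ) (ω : ℕ) : Matrix V V ℝ :=
  Matrix.diagonal (fun i => ∑ j ∈ gBall G i ω, |H i j|)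

/-- The spectral radius of a square real matrix: the supremum of the moduli of its
complex eigenvalues. -/
noncomputable def specRad {n : Type*} [Fintype n] [DecidableEq n] (A : Matrix n n ℝ) : ℝ :=
  sSup {r : ℝ | ∃ μ : ℂ,
    Module.End.HasEigenvalue (Matrix.toLin' (A.map Complex.ofReal)) μ ∧ r = ‖μ‖}

/-- The ℓ² norm `‖x‖₂ = (Σ_j |x(j)|²)^{1/2}` of a vector `x`. -/
noncomputable def l2norm {V : Type*} [Fintype V] (x : V → ℝ) : ℝ :=
  Real.sqrt (∑ j, (x j) ^ 2)

/-- The Schur norm `‖H‖_S = max( max_i Σ_j |H(i,j)|, max_j Σ_i |H(i,j)| )`. -/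
noncomputable def schurNorm {V : Type*} [Fintype V] [Nonempty V] (H : Matrix V V ℝ) : ℝ :=
  max (Finset.univ.sup' Finset.univ_nonempty (fun i => ∑ j, |H i j|))
      (Finset.univ.sup' Finset.univ_nonempty (fun j => ∑ i, |H i j|))

/-- **Theorem 1 (preconditioning inequality).** If `H` has geodesic-width `ω`
on the connected graph `G`, then `HᵀH ⪯ P_H²`. -/
theorem precond_dominates_HtH {V : Type*} [Fintype V] [DecidableEq V]
    (G : SimpleGraph V) (hG : G.Connected)
    (H : Matrix V V ℝ) (ω : ℕ) (hω : ∀ i j : V, ω < G.dist i j → H i j = 0) :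
    ((precond G H ω) ^ 2 - Hᵀ * H).PosSemidef := by
  have key : ∃ p : V → ℝ, precond G H ω = Matrix.diagonal p ∧
      (∀ i j, H i j ≠ 0 → ∑ k, |H i k| ≤ p j) ∧ (∀ j, ∑ i, |H i j| ≤ p j) := by
    have hrow : ∀ i, ∑ k ∈ gBall G i ω, |H i k| = ∑ k, |H i k| := by
      intro i
      apply Finset.sum_subset (Finset.subset_univ _)
      intro k _ hk
      have : ω < G.dist i k := by
        rw [SimpleGraph.dist_comm]
        simpa [gBall] using hk
      simp [hω i k this]
    have hcol : ∀ i, ∑ k ∈ gBall G i ω, |H k i| = ∑ k, |H k i| := by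
      intro i
      apply Finset.sum_subset (Finset.subset_univ _)
      intro k _ hk
      have : ω < G.dist k i := by simpa [gBall] using hk
      simp [hω k i this]
    refine ⟨_, rfl, ?_, ?_⟩
    · intro i j hij
      have hmem : i ∈ gBall G j ω := by
        have : G.dist i j ≤ ω := by
          by_contra h
          exact hij (hω i j (not_le.mp h))
        simpa [gBall] using this
      rw [← hrow]
      exact (le_max_right _ _).trans (Finset.le_sup' (fun k =>
        max (∑ j ∈ gBall G k ω, |H j k|) (∑ j ∈ gBall G k ω, |H k j|)) hmem)
    · intro j
      have hmem : j ∈ gBall G j ω := by simp [gBall]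
      rw [← hcol]
      exact (le_max_left _ _).trans (Finset.le_sup' (fun k =>
        max (∑ j ∈ gBall G k ω, |H j k|) (∑ j ∈ gBall G k ω, |H k j|)) hmem)
  obtain ⟨p, hp, hr, hc⟩ := key
  have hp0 : ∀ j, 0 ≤ p j := fun j =>
    (Finset.sum_nonneg fun i _ => abs_nonneg (H i j)).trans (hc j)
  rw [hp, pow_two, Matrix.diagonal_mul_diagonal]
  refine Matrix.PosSemidef.of_dotProduct_mulVec_nonneg ?_ ?_
  · refine (Matrix.isHermitian_diagonal _).sub ?_
    simpa using Matrix.isHermitian_conjTranspose_mul_self H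
  · intro x
    have e : star x ⬝ᵥ ((Matrix.diagonal (fun i => p i * p i) - Hᵀ * H) *ᵥ x)
        = ∑ j, p j * p j * x j ^ 2 - ∑ i, (∑ j, H i j * x j) ^ 2 := by
      rw [Matrix.sub_mulVec, dotProduct_sub, ← Matrix.mulVec_mulVec,
        Matrix.dotProduct_mulVec _ Hᵀ, Matrix.vecMul_transpose]
      congr 1
      · simp only [dotProduct, Matrix.mulVec_diagonal, star_trivial]
        exact Finset.sum_congr rfl fun i _ => by ring
      · simp only [dotProduct, Matrix.mulVec, star_trivial, pow_two]
    rw [e, sub_nonneg]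
    calc ∑ i, (∑ j, H i j * x j) ^ 2
        ≤ ∑ i, (∑ j, |H i j|) * ∑ j, |H i j| * x j ^ 2 := by
          refine Finset.sum_le_sum fun i _ => ?_
          refine Finset.sum_sq_le_sum_mul_sum_of_sq_le_mul _ (fun _ _ => abs_nonneg _)
            (fun _ _ => by positivity) (fun j _ => ?_)
          rw [mul_pow, ← sq_abs (H i j)]
          exact le_of_eq (by ring)
      _ ≤ ∑ i, ∑ j, p j * |H i j| * x j ^ 2 := by
          refine Finset.sum_le_sum fun i _ => ?_
          rw [Finset.mul_sum]
          refine Finset.sum_le_sum fun j _ => ?_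
          by_cases h : H i j = 0
          · simp [h]
          · rw [mul_assoc]
            exact mul_le_mul_of_nonneg_right (hr i j h) (by positivity)
      _ = ∑ j, p j * (∑ i, |H i j|) * x j ^ 2 := by
          rw [Finset.sum_comm]
          exact Finset.sum_congr rfl fun j _ => by rw [Finset.mul_sum, Finset.sum_mul]
      _ ≤ ∑ j, p j * p j * x j ^ 2 := by
          refine Finset.sum_le_sum fun j _ => ?_
          exact mul_le_mul_of_nonneg_right
            (mul_le_mul_of_nonneg_left (hc j) (hp0 j)) (sq_nonneg _)
end

section
/- Let G be a connected simple graph on a finite vertex set V, let H be an invertible real matrix indexed by V × V with geodesic-width ω(H), and let P_H be the associated diagonal preconditioning matrix (which is invertible). Then the spectral radius of I − P_H⁻¹ Hᵀ H P_H⁻¹ is strictly less than 1. -/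
open Matrix BigOperators Finset Filter

lemma aux_schur {V : Type*} [Fintype V] (H : Matrix V V ℝ) (p : V → ℝ)
    (hR : ∀ i j, H i j ≠ 0 → ∑ k, |H i k| ≤ p j) (hp : ∀ j, 0 ≤ p j)
    (hC : ∀ j, ∑ i, |H i j| ≤ p j) (y : V → ℂ) :
    ∑ i, ‖∑ j, (H i j : ℂ) * y j‖ ^ 2 ≤ ∑ j, (p j * ‖y j‖) ^ 2 := by
  have h1 : ∀ i, ‖∑ j, (H i j : ℂ) * y j‖ ^ 2 ≤ ∑ j, p j * (|H i j| * ‖y j‖ ^ 2) := by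
    intro i
    have a : ‖∑ j, (H i j : ℂ) * y j‖ ≤ ∑ j, |H i j| * ‖y j‖ := by
      refine (norm_sum_le _ _).trans (le_of_eq ?_)
      simp
    have b : (∑ j, |H i j| * ‖y j‖) ^ 2 ≤ (∑ j, |H i j|) * ∑ j, |H i j| * ‖y j‖ ^ 2 := by
      apply Finset.sum_sq_le_sum_mul_sum_of_sq_eq_mul
      · intro j _; positivity
      · intro j _; positivity
      · intro j _; ring
    refine (pow_le_pow_left₀ (norm_nonneg _) a 2).trans (b.trans ?_)
    rw [Finset.mul_sum]
    refine Finset.sum_le_sum fun j _ => ?_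
    by_cases h : H i j = 0
    · simp [h]
    · exact mul_le_mul_of_nonneg_right (hR i j h) (by positivity)
  refine (Finset.sum_le_sum fun i _ => h1 i).trans ?_
  rw [Finset.sum_comm]
  refine Finset.sum_le_sum fun j _ => ?_
  have : ∑ i, p j * (|H i j| * ‖y j‖ ^ 2) = p j * ‖y j‖ ^ 2 * ∑ i, |H i j| := by
    rw [Finset.mul_sum]
    exact Finset.sum_congr rfl fun i _ => by ring
  rw [this]
  have := mul_le_mul_of_nonneg_left (hC j) (mul_nonneg (hp j) (sq_nonneg ‖y j‖))
  nlinarith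

lemma aux_dot {V : Type*} [Fintype V] (x : V → ℂ) :
    star x ⬝ᵥ x = ((∑ i, ‖x i‖ ^ 2 : ℝ) : ℂ) := by
  simp only [dotProduct, Pi.star_apply, RCLike.star_def, Complex.conj_mul']
  push_cast
  rfl

lemma aux_pos {V : Type*} [Fintype V] (x : V → ℂ) (hx : x ≠ 0) : 0 < ∑ i, ‖x i‖ ^ 2 := by
  obtain ⟨i, hi⟩ := Function.ne_iff.mp hx
  refine Finset.sum_pos' (fun i _ => by positivity) ⟨i, Finset.mem_univ _, ?_⟩
  have : 0 < ‖x i‖ := norm_pos_iff.mpr hi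
  positivity

lemma aux_eig {V : Type*} [Fintype V] [DecidableEq V] (K : Matrix V V ℝ) (hK : IsUnit K)
    (hb : ∀ x : V → ℂ, ∑ i, ‖(K.map Complex.ofReal *ᵥ x) i‖ ^ 2 ≤ ∑ i, ‖x i‖ ^ 2)
    (μ : ℂ)
    (h : Module.End.HasEigenvalue (Matrix.toLin' ((1 - Kᵀ * K).map Complex.ofReal)) μ) :
    ‖μ‖ < 1 := by
  obtain ⟨x, hx⟩ := h.exists_hasEigenvector
  have hx0 := hx.2
  have hxe := hx.apply_eq_smul
  set L : Matrix V V ℂ := K.map Complex.ofReal with hL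
  have hL1 : (1 - Kᵀ * K).map Complex.ofReal = 1 - Lᴴ * L := by
    have e : Lᴴ = Kᵀ.map Complex.ofReal := by
      ext i j; simp [hL]
    rw [e, hL]
    ext i j
    simp [Matrix.mul_apply, Matrix.one_apply]
    split_ifs <;> simp
  have hLu : IsUnit L := hK.map (Complex.ofRealHom.mapMatrix)
  rw [hL1, Matrix.toLin'_apply, Matrix.sub_mulVec, Matrix.one_mulVec, ← Matrix.mulVec_mulVec] at hxe
  have e := congrArg (fun v => star x ⬝ᵥ v) hxe
  simp only [dotProduct_sub, dotProduct_smul, smul_eq_mul] at e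
  rw [Matrix.dotProduct_mulVec, ← Matrix.star_mulVec, aux_dot, aux_dot] at e
  have hz : L *ᵥ x ≠ 0 := by
    intro h0
    apply hx0
    apply Matrix.mulVec_injective_of_isUnit hLu
    simp [h0]
  have p1 := aux_pos x hx0
  have p2 := aux_pos _ hz
  have p3 := hb x
  set a := ∑ i, ‖x i‖ ^ 2
  set b := ∑ i, ‖(L *ᵥ x) i‖ ^ 2
  have hμ : μ = (((a - b) / a : ℝ) : ℂ) := by
    have : (a : ℂ) ≠ 0 := by exact_mod_cast p1.ne'
    push_cast
    rw [e]; field_simp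
  rw [hμ, Complex.norm_real, Real.norm_eq_abs, abs_lt]
  constructor
  · exact lt_of_lt_of_le (by norm_num) (div_nonneg (by linarith) p1.le)
  · rw [div_lt_one p1]; linarith

/-- For an invertible filter `H` with geodesic-width `ω`, the spectral radius of
`I − P_H⁻¹ Hᵀ H P_H⁻¹` is strictly less than `1`. -/
theorem specRad_preconditioned_lt_one {V : Type*} [Fintype V] [DecidableEq V]
    (G : SimpleGraph V) (hG : G.Connected)
    (H : Matrix V V ℝ) (ω : ℕ) (hω : ∀ i j : V, ω < G.dist i j → H i j = 0)
    (hinv : IsUnit H) :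
    specRad (1 - (precond G H ω)⁻¹ * Hᵀ * H * (precond G H ω)⁻¹) < 1 := by
  obtain ⟨p, hpdef⟩ : ∃ p : V → ℝ, p = (fun i =>
    (gBall G i ω).sup' (gBall_nonempty G i ω) (fun k =>
      max (∑ j ∈ gBall G k ω, |H j k|) (∑ j ∈ gBall G k ω, |H k j|))) := ⟨_, rfl⟩
  have hP : precond G H ω = Matrix.diagonal p := by rw [hpdef]; rfl
  have hcol : ∀ k, ∑ j ∈ gBall G k ω, |H j k| = ∑ j, |H j k| := by
    intro k
    refine Finset.sum_subset (Finset.subset_univ _) fun j _ hj => ?_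
    rw [hω j k (by simpa [gBall] using hj), abs_zero]
  have hrow : ∀ k, ∑ j ∈ gBall G k ω, |H k j| = ∑ j, |H k j| := by
    intro k
    refine Finset.sum_subset (Finset.subset_univ _) fun j _ hj => ?_
    rw [hω k j (by rw [SimpleGraph.dist_comm]; simpa [gBall] using hj), abs_zero]
  have hmem : ∀ i k, k ∈ gBall G i ω → max (∑ j, |H j k|) (∑ j, |H k j|) ≤ p i := by
    intro i k hk
    rw [hpdef, ← hcol, ← hrow]
    exact Finset.le_sup' (fun k =>
      max (∑ j ∈ gBall G k ω, |H j k|) (∑ j ∈ gBall G k ω, |H k j|)) hk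
  have hC : ∀ j, ∑ i, |H i j| ≤ p j := fun j =>
    (le_max_left _ _).trans (hmem j j (by simp [gBall]))
  have hR : ∀ i j, H i j ≠ 0 → ∑ k, |H i k| ≤ p j := fun i j h =>
    (le_max_right _ _).trans (hmem j i (by
      have := mt (hω i j) h
      simpa [gBall] using this))
  have hp : ∀ j, 0 < p j := by
    intro j
    refine lt_of_lt_of_le ?_ (hC j)
    by_contra hcon
    have h0 : ∑ i, |H i j| = 0 :=
      le_antisymm (not_lt.mp hcon) (Finset.sum_nonneg fun _ _ => abs_nonneg _)
    rw [Finset.sum_eq_zero_iff_of_nonneg (fun _ _ => abs_nonneg _)] at h0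
    have hd : H.det = 0 := Matrix.det_eq_zero_of_column_eq_zero j fun i => by
      simpa using h0 i (Finset.mem_univ _)
    have := (Matrix.isUnit_iff_isUnit_det H).mp hinv
    rw [hd] at this
    simp at this
  have hPi : (precond G H ω)⁻¹ = Matrix.diagonal (fun i => (p i)⁻¹) := by
    rw [hP]
    apply Matrix.inv_eq_right_inv
    rw [Matrix.diagonal_mul_diagonal, ← Matrix.diagonal_one]
    congr 1
    funext i
    exact mul_inv_cancel₀ (hp i).ne'
  rw [hPi]
  have hDu : IsUnit (Matrix.diagonal (fun i => (p i)⁻¹) : Matrix V V ℝ) := by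
    rw [Matrix.isUnit_iff_isUnit_det, Matrix.det_diagonal, isUnit_iff_ne_zero]
    exact Finset.prod_ne_zero_iff.mpr fun i _ => inv_ne_zero (hp i).ne'
  have hform : Matrix.diagonal (fun i => (p i)⁻¹) * Hᵀ * H * Matrix.diagonal (fun i => (p i)⁻¹)
      = (H * Matrix.diagonal (fun i => (p i)⁻¹))ᵀ * (H * Matrix.diagonal (fun i => (p i)⁻¹)) := by
    rw [Matrix.transpose_mul, Matrix.diagonal_transpose]
    simp only [Matrix.mul_assoc]
  rw [hform]
  have key := aux_eig (H * Matrix.diagonal (fun i => (p i)⁻¹)) (hinv.mul hDu) (by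
    intro x
    have := aux_schur H p hR (fun j => (hp j).le) hC (fun j => ((p j)⁻¹ : ℝ) * x j)
    refine le_trans (le_of_eq ?_) (this.trans (le_of_eq ?_))
    · refine Finset.sum_congr rfl fun i _ => ?_
      simp [Matrix.mulVec, dotProduct, mul_assoc]
    · refine Finset.sum_congr rfl fun i _ => ?_
      rw [norm_mul, Complex.norm_real, Real.norm_of_nonneg (inv_nonneg.mpr (hp i).le),
        mul_inv_cancel_left₀ (hp i).ne'])
  unfold specRad
  set S := {r : ℝ | ∃ μ : ℂ, Module.End.HasEigenvalue (Matrix.toLin'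
    ((1 - (H * Matrix.diagonal (fun i => (p i)⁻¹))ᵀ *
      (H * Matrix.diagonal (fun i => (p i)⁻¹))).map Complex.ofReal)) μ ∧ r = ‖μ‖} with hS
  have hfin : S.Finite := by
    refine ((Module.End.finite_hasEigenvalue (Matrix.toLin'
    ((1 - (H * Matrix.diagonal (fun i => (p i)⁻¹))ᵀ *
      (H * Matrix.diagonal (fun i => (p i)⁻¹))).map Complex.ofReal))).image
        (fun μ : ℂ => ‖μ‖)).subset ?_
    rintro r ⟨μ, h, rfl⟩
    exact ⟨μ, h, rfl⟩
  rcases S.eq_empty_or_nonempty with h | h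
  · rw [h, Real.sSup_empty]; norm_num
  · obtain ⟨μ, hμ, hr⟩ := h.csSup_mem hfin
    rw [hr]
    exact key μ hμ
end

section
/- Let G be a connected simple graph on a finite vertex set V, let H be an invertible real matrix indexed by V × V with geodesic-width ω(H), and let P_H be the associated diagonal preconditioning matrix. Given y ∈ ℝ^V and any initial vector x⁽⁰⁾ ∈ ℝ^V, define x⁽ᵐ⁾ = x⁽ᵐ⁻¹⁾ − P_H⁻² Hᵀ (H x⁽ᵐ⁻¹⁾ − y) for m ≥ 1. Then the sequence x⁽ᵐ⁾ converges to H⁻¹y as m → ∞. -/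
open Matrix BigOperators Finset Filter

lemma schur_bound {V : Type*} [Fintype V] [DecidableEq V] (H : Matrix V V ℝ) (p : V → ℝ)
    (hc : ∀ j, ∑ i, |H i j| ≤ p j) (hr : ∀ i j, H i j ≠ 0 → ∑ k, |H i k| ≤ p j) (u : V → ℝ) :
    ∑ i, (H *ᵥ u) i ^ 2 ≤ ∑ j, p j ^ 2 * u j ^ 2 := by
  have h1 : ∀ i, (H *ᵥ u) i ^ 2 ≤ ∑ j, (|H i j| * p j) * u j ^ 2 := by
    intro i
    have hcs : (H *ᵥ u) i ^ 2 ≤ (∑ j, |H i j|) * ∑ j, |H i j| * u j ^ 2 := by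
      apply Finset.sum_sq_le_sum_mul_sum_of_sq_le_mul
      · intro j _; positivity
      · intro j _; positivity
      · intro j _
        apply le_of_eq
        rw [mul_pow, ← sq_abs (H i j)]; ring
    refine hcs.trans ?_
    rw [Finset.mul_sum]
    refine Finset.sum_le_sum fun j _ => ?_
    by_cases h0 : H i j = 0
    · simp [h0]
    · have h2 : 0 ≤ |H i j| * u j ^ 2 := by positivity
      calc _ ≤ p j * (|H i j| * u j ^ 2) := mul_le_mul_of_nonneg_right (hr i j h0) h2
        _ = _ := by ring
  refine (Finset.sum_le_sum fun i _ => h1 i).trans ?_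
  rw [Finset.sum_comm]
  refine Finset.sum_le_sum fun j _ => ?_
  rw [← Finset.sum_mul, ← Finset.sum_mul, sq (p j)]
  have hp : 0 ≤ p j := (Finset.sum_nonneg fun i _ => abs_nonneg (H i j)).trans (hc j)
  exact mul_le_mul_of_nonneg_right (mul_le_mul_of_nonneg_right (hc j) hp) (sq_nonneg _)

lemma step_bound {V : Type*} [Fintype V] [DecidableEq V] (H : Matrix V V ℝ) (p : V → ℝ)
    (hb : ∀ u : V → ℝ, ∑ i, (H *ᵥ u) i ^ 2 ≤ ∑ j, p j ^ 2 * u j ^ 2)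
    (e v : V → ℝ) (hv : ∀ i, p i ^ 2 * v i = (Hᵀ *ᵥ (H *ᵥ e)) i) :
    ∑ i, (H *ᵥ e) i ^ 2 ≤ ∑ i, p i ^ 2 * e i ^ 2 - ∑ i, p i ^ 2 * (e - v) i ^ 2 := by
  have key : ∀ u : V → ℝ, ∑ i, u i * (p i ^ 2 * v i) = ∑ i, (H *ᵥ u) i * (H *ᵥ e) i := by
    intro u
    simp_rw [hv]
    change u ⬝ᵥ (Hᵀ *ᵥ (H *ᵥ e)) = (H *ᵥ u) ⬝ᵥ (H *ᵥ e)
    rw [Matrix.dotProduct_mulVec, Matrix.vecMul_transpose]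
  have k1 := key e
  have k2 := key v
  have k3 := hb v
  have k4 : 0 ≤ ∑ i, ((H *ᵥ e) i - (H *ᵥ v) i) ^ 2 := Finset.sum_nonneg fun i _ => sq_nonneg _
  have k5 : ∑ i, ((H *ᵥ e) i - (H *ᵥ v) i) ^ 2 = ∑ i, (H *ᵥ e) i ^ 2
      - 2 * ∑ i, (H *ᵥ v) i * (H *ᵥ e) i + ∑ i, (H *ᵥ v) i ^ 2 := by
    rw [Finset.mul_sum, ← Finset.sum_sub_distrib, ← Finset.sum_add_distrib]
    exact Finset.sum_congr rfl fun i _ => by ring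
  have k6 : ∑ i, p i ^ 2 * (e - v) i ^ 2 = ∑ i, p i ^ 2 * e i ^ 2
      - 2 * ∑ i, e i * (p i ^ 2 * v i) + ∑ i, p i ^ 2 * v i ^ 2 := by
    rw [Finset.mul_sum, ← Finset.sum_sub_distrib, ← Finset.sum_add_distrib]
    exact Finset.sum_congr rfl fun i _ => by simp only [Pi.sub_apply]; ring
  have k7 : ∑ i, v i * (p i ^ 2 * v i) = ∑ i, p i ^ 2 * v i ^ 2 :=
    Finset.sum_congr rfl fun i _ => by ring
  have k8 : ∑ i, (H *ᵥ e) i * (H *ᵥ e) i = ∑ i, (H *ᵥ e) i ^ 2 :=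
    Finset.sum_congr rfl fun i _ => by ring
  linarith

/-- The PGDA iterates converge to the output `H⁻¹ y` of the inverse filtering procedure. -/
theorem pgda_tendsto {V : Type*} [Fintype V] [DecidableEq V]
    (G : SimpleGraph V) (hG : G.Connected)
    (H : Matrix V V ℝ) (ω : ℕ) (hω : ∀ i j : V, ω < G.dist i j → H i j = 0)
    (hinv : IsUnit H) (y : V → ℝ) (x : ℕ → V → ℝ)
    (hiter : ∀ m : ℕ,
      x (m + 1) = x m - ((precond G H ω)⁻¹ ^ 2 * Hᵀ) *ᵥ (H *ᵥ x m - y)) :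
    Filter.Tendsto x Filter.atTop (nhds (H⁻¹ *ᵥ y)) := by
  have hmem : ∀ i j, H i j ≠ 0 → G.dist i j ≤ ω := fun i j h => by
    by_contra hlt
    exact h (hω i j (not_le.mp hlt))
  have hcol : ∀ k, ∑ j ∈ gBall G k ω, |H j k| = ∑ j, |H j k| := fun k => by
    refine Finset.sum_subset (Finset.subset_univ _) fun j _ hj => ?_
    by_contra h
    exact hj (by simpa [gBall] using hmem j k (by simpa using h))
  have hrow : ∀ k, ∑ j ∈ gBall G k ω, |H k j| = ∑ j, |H k j| := fun k => by
    refine Finset.sum_subset (Finset.subset_univ _) fun j _ hj => ?_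
    by_contra h
    exact hj (by simpa [gBall, SimpleGraph.dist_comm] using hmem k j (by simpa using h))
  obtain ⟨p, hpd, hp⟩ : ∃ p : V → ℝ, precond G H ω = Matrix.diagonal p ∧
      ∀ i, ∀ k ∈ gBall G i ω, max (∑ j, |H j k|) (∑ j, |H k j|) ≤ p i := by
    refine ⟨_, rfl, fun i k hk => ?_⟩
    rw [← hcol, ← hrow]
    exact Finset.le_sup' (fun k =>
      max (∑ j ∈ gBall G k ω, |H j k|) (∑ j ∈ gBall G k ω, |H k j|)) hk
  have hb := schur_bound H p
    (fun j => (le_max_left _ _).trans (hp j j (by simp [gBall])))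
    (fun i j h => (le_max_right _ _).trans (hp j i (by simpa [gBall] using hmem i j h)))
  have hdet : IsUnit H.det := (Matrix.isUnit_iff_isUnit_det H).mp hinv
  have hp0 : ∀ i, p i ≠ 0 := by
    intro i hi
    have h1 := hb (Pi.single i 1)
    have h2 : ∑ j, p j ^ 2 * (Pi.single i (1 : ℝ) : V → ℝ) j ^ 2 = 0 := by
      refine Finset.sum_eq_zero fun j _ => ?_
      by_cases hj : j = i
      · subst hj; simp [hi]
      · simp [hj]
    rw [h2] at h1
    have h3 : H *ᵥ Pi.single i (1 : ℝ) = 0 := by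
      have h4 := (Finset.sum_eq_zero_iff_of_nonneg (fun j _ => sq_nonneg _)).mp
        (le_antisymm h1 (Finset.sum_nonneg fun j _ => sq_nonneg _))
      funext j
      simpa using h4 j (Finset.mem_univ j)
    have h5 : H⁻¹ *ᵥ (H *ᵥ Pi.single i (1 : ℝ)) = Pi.single i 1 := by
      rw [Matrix.mulVec_mulVec, Matrix.nonsing_inv_mul _ hdet, Matrix.one_mulVec]
    rw [h3, Matrix.mulVec_zero] at h5
    have h6 := congrFun h5 i
    simp at h6
  have hPinv : (precond G H ω)⁻¹ = Matrix.diagonal (fun i => (p i)⁻¹) := by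
    rw [hpd]
    apply Matrix.inv_eq_right_inv
    rw [Matrix.diagonal_mul_diagonal, ← Matrix.diagonal_one]
    congr 1
    funext i
    exact mul_inv_cancel₀ (hp0 i)
  set z := H⁻¹ *ᵥ y with hz
  have hHz : H *ᵥ z = y := by
    rw [hz, Matrix.mulVec_mulVec, Matrix.mul_nonsing_inv _ hdet, Matrix.one_mulVec]
  set N : ℕ → ℝ := fun m => ∑ i, p i ^ 2 * (x m - z) i ^ 2 with hN
  have hstep : ∀ m, ∑ i, (H *ᵥ (x m - z)) i ^ 2 ≤ N m - N (m + 1) := by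
    intro m
    have hs := step_bound H p hb (x m - z)
      (((precond G H ω)⁻¹ ^ 2 * Hᵀ) *ᵥ (H *ᵥ x m - y)) (by
        intro i
        rw [Matrix.mulVec_sub H (x m) z, hHz, hPinv, Matrix.diagonal_pow, ← Matrix.mulVec_mulVec,
          Matrix.mulVec_diagonal, Pi.pow_apply, ← mul_assoc, ← mul_pow,
          mul_inv_cancel₀ (hp0 i), one_pow, one_mul])
    have he : x m - z - (((precond G H ω)⁻¹ ^ 2 * Hᵀ) *ᵥ (H *ᵥ x m - y)) = x (m + 1) - z := by
      rw [hiter m, sub_right_comm]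
    rw [he] at hs
    exact hs
  have hanti : Antitone N := antitone_nat_of_succ_le fun m => by
    have h1 : 0 ≤ ∑ i, (H *ᵥ (x m - z)) i ^ 2 := Finset.sum_nonneg fun i _ => sq_nonneg _
    linarith [hstep m]
  have hlim := tendsto_atTop_ciInf hanti
    ⟨0, by rintro _ ⟨m, rfl⟩; exact Finset.sum_nonneg fun i _ => by positivity⟩
  have hdiff : Tendsto (fun m => N m - N (m + 1)) atTop (nhds 0) := by
    simpa using hlim.sub (hlim.comp (tendsto_add_atTop_nat 1))
  have hH0 : Tendsto (fun m => H *ᵥ (x m - z)) atTop (nhds 0) := by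
    rw [tendsto_pi_nhds]
    intro i
    have h1 : Tendsto (fun m => (H *ᵥ (x m - z)) i ^ 2) atTop (nhds 0) :=
      squeeze_zero (fun m => sq_nonneg _) (fun m =>
        (Finset.single_le_sum (f := fun i => (H *ᵥ (x m - z)) i ^ 2)
          (fun j _ => sq_nonneg _) (Finset.mem_univ i)).trans (hstep m)) hdiff
    have h2 := h1.sqrt
    simp only [Real.sqrt_sq_eq_abs, Real.sqrt_zero] at h2
    exact (tendsto_zero_iff_abs_tendsto_zero _).mpr h2
  have hcont : Continuous fun u : V → ℝ => H⁻¹ *ᵥ u + z := by fun_prop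
  have hfin := (hcont.tendsto 0).comp hH0
  simp only [Matrix.mulVec_zero, zero_add] at hfin
  refine hfin.congr fun m => ?_
  simp [Function.comp, Matrix.mulVec_mulVec, Matrix.nonsing_inv_mul _ hdet]
end

section
/- Let G be a connected simple graph on a finite vertex set V and let H be a symmetric positive definite real matrix indexed by V × V with geodesic-width ω(H). Then the spectral radius of I − (P_H^sym)^{-1} H is strictly less than 1, and it equals the spectral radius of I − (P_H^sym)^{-1/2} H (P_H^sym)^{-1/2}. -/
open Matrix BigOperators Finset Filter

lemma specRad_congr {n : Type*} [Fintype n] [DecidableEq n] (A B : Matrix n n ℝ)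
    (h : A.charpoly = B.charpoly) : specRad A = specRad B := by
  have key : ∀ (A : Matrix n n ℝ) (μ : ℂ),
      Module.End.HasEigenvalue (Matrix.toLin' (A.map Complex.ofReal)) μ ↔
        (A.charpoly.map Complex.ofRealHom).IsRoot μ := by
    intro A μ
    rw [Module.End.hasEigenvalue_iff_isRoot_charpoly, Matrix.charpoly_toLin', ← Matrix.charpoly_map]
    rfl
  unfold specRad
  simp only [key, h]

lemma quad_le {V : Type*} [Fintype V] (H : Matrix V V ℝ) (hs : ∀ i j, H i j = H j i)
    (a : V → ℝ) : a ⬝ᵥ (H *ᵥ a) ≤ ∑ i, (∑ j, |H i j|) * a i ^ 2 := by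
  have h1 : a ⬝ᵥ (H *ᵥ a) ≤ ∑ i, ∑ j, (|H i j| * a i ^ 2 / 2 + |H i j| * a j ^ 2 / 2) := by
    simp only [dotProduct, mulVec, Finset.mul_sum]
    refine Finset.sum_le_sum fun i _ => Finset.sum_le_sum fun j _ => ?_
    have h2 := le_abs_self (H i j * (a i * a j))
    rw [abs_mul] at h2
    have h3 : |a i * a j| ≤ (a i ^ 2 + a j ^ 2) / 2 := by
      rw [abs_le]
      constructor <;> nlinarith [sq_nonneg (a i + a j), sq_nonneg (a i - a j)]
    have h4 := mul_le_mul_of_nonneg_left h3 (abs_nonneg (H i j))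
    nlinarith
  refine h1.trans (le_of_eq ?_)
  simp only [Finset.sum_add_distrib]
  rw [Finset.sum_comm (f := fun i j => |H i j| * a j ^ 2 / 2)]
  rw [← Finset.sum_add_distrib]
  refine Finset.sum_congr rfl fun i _ => ?_
  rw [Finset.sum_mul, ← Finset.sum_add_distrib]
  refine Finset.sum_congr rfl fun j _ => ?_
  rw [hs j i]; ring

lemma eig_lt {V : Type*} [Fintype V] [DecidableEq V] (H : Matrix V V ℝ) (hH : H.PosDef)
    (p : V → ℝ) (hp : ∀ i, p i = ∑ j, |H i j|) (hpos : ∀ i, 0 < p i) (μ : ℂ)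
    (hμ : Module.End.HasEigenvalue
      (Matrix.toLin' ((1 - (Matrix.diagonal p)⁻¹ * H).map Complex.ofReal)) μ) : ‖μ‖ < 1 := by
  obtain ⟨v, hv⟩ := hμ.exists_hasEigenvector
  have hv0 := hv.2
  have hv1 := hv.apply_eq_smul
  have hs : ∀ i j, H i j = H j i := fun i j => by
    have := hH.isHermitian.apply i j
    simpa using this.symm
  have hinv : (Matrix.diagonal p)⁻¹ = Matrix.diagonal (fun i => (p i)⁻¹) := by
    apply Matrix.inv_eq_right_inv
    rw [Matrix.diagonal_mul_diagonal, ← Matrix.diagonal_one]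
    congr 1; funext i; exact mul_inv_cancel₀ (hpos i).ne'
  rw [hinv] at hv1
  set a : V → ℝ := fun i => (v i).re with ha
  set b : V → ℝ := fun i => (v i).im with hb
  have hM : ((1 - Matrix.diagonal (fun i => (p i)⁻¹) * H).map Complex.ofReal)
      = 1 - Matrix.of (fun i j => (((p i)⁻¹ * H i j : ℝ) : ℂ)) := by
    ext i j
    by_cases h : i = j <;> simp [Matrix.diagonal_mul, h]
  have hrow : ∀ i, v i - ∑ j, (((p i)⁻¹ * H i j : ℝ) : ℂ) * v j = μ * v i := by
    intro i
    have := congrFun hv1 i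
    rw [hM, Matrix.toLin'_apply, Matrix.sub_mulVec, Matrix.one_mulVec] at this
    simpa [mulVec, dotProduct] using this
  have hre : ∀ i, (H *ᵥ a) i = p i * ((1 - μ.re) * a i + μ.im * b i) := by
    intro i
    have := congrArg Complex.re (hrow i)
    simp only [Complex.sub_re, Complex.re_sum, Complex.mul_re, Complex.ofReal_re, Complex.ofReal_im, zero_mul, sub_zero, mul_assoc,
      ← Finset.mul_sum] at this
    have h2 : (p i)⁻¹ * (H *ᵥ a) i = (1 - μ.re) * a i + μ.im * b i := by
      simp only [mulVec, dotProduct, ha, hb]; linarith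
    rw [← h2, mul_inv_cancel_left₀ (hpos i).ne']
  have him : ∀ i, (H *ᵥ b) i = p i * ((1 - μ.re) * b i - μ.im * a i) := by
    intro i
    have := congrArg Complex.im (hrow i)
    simp only [Complex.sub_im, Complex.im_sum, Complex.mul_im, Complex.ofReal_re, Complex.ofReal_im, zero_mul, add_zero, mul_assoc,
      ← Finset.mul_sum] at this
    have h2 : (p i)⁻¹ * (H *ᵥ b) i = (1 - μ.re) * b i - μ.im * a i := by
      simp only [mulVec, dotProduct, ha, hb]; linarith
    rw [← h2, mul_inv_cancel_left₀ (hpos i).ne']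
  have hsym : b ⬝ᵥ (H *ᵥ a) = a ⬝ᵥ (H *ᵥ b) := by
    simp only [dotProduct, mulVec, Finset.mul_sum]
    rw [Finset.sum_comm]
    refine Finset.sum_congr rfl fun i _ => Finset.sum_congr rfl fun j _ => ?_
    rw [hs j i]; ring
  set s : ℝ := ∑ i, p i * (a i ^ 2 + b i ^ 2) with hsdef
  have e1 : b ⬝ᵥ (H *ᵥ a) - a ⬝ᵥ (H *ᵥ b) = μ.im * s := by
    simp only [dotProduct, hre, him, hsdef, Finset.mul_sum, ← Finset.sum_sub_distrib]
    refine Finset.sum_congr rfl fun i _ => ?_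
    ring
  have e2 : a ⬝ᵥ (H *ᵥ a) + b ⬝ᵥ (H *ᵥ b) = (1 - μ.re) * s := by
    simp only [dotProduct, hre, him, hsdef, Finset.mul_sum, ← Finset.sum_add_distrib]
    refine Finset.sum_congr rfl fun i _ => ?_
    ring
  have hle : a ⬝ᵥ (H *ᵥ a) + b ⬝ᵥ (H *ᵥ b) ≤ s := by
    have h1 := quad_le H hs a
    have h2 := quad_le H hs b
    have h3 : s = ∑ i, (∑ j, |H i j|) * a i ^ 2 + ∑ i, (∑ j, |H i j|) * b i ^ 2 := by
      rw [hsdef, ← Finset.sum_add_distrib]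
      refine Finset.sum_congr rfl fun i _ => ?_
      rw [← hp]; ring
    linarith
  have nn : ∀ x : V → ℝ, 0 ≤ x ⬝ᵥ (H *ᵥ x) := fun x => by
    simpa using hH.posSemidef.dotProduct_mulVec_nonneg x
  have pp : ∀ x : V → ℝ, x ≠ 0 → 0 < x ⬝ᵥ (H *ᵥ x) := fun x hx => by
    simpa using hH.dotProduct_mulVec_pos hx
  have hq : 0 < a ⬝ᵥ (H *ᵥ a) + b ⬝ᵥ (H *ᵥ b) := by
    by_cases h : a = 0
    · have hb0 : b ≠ 0 := by
        intro h'
        exact hv0 (funext fun i => Complex.ext (congrFun h i) (congrFun h' i))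
      linarith [nn a, pp b hb0]
    · linarith [nn b, pp a h]
  have hspos : 0 < s := lt_of_lt_of_le hq hle
  have him0 : μ.im = 0 := by
    rw [hsym, sub_self] at e1
    rcases mul_eq_zero.mp e1.symm with h | h
    · exact h
    · exact absurd h hspos.ne'
  have hμr : μ = (μ.re : ℂ) := Complex.ext rfl (by simp [him0])
  rw [hμr, Complex.norm_real, Real.norm_eq_abs, abs_lt]
  rw [e2] at hq hle
  constructor
  · nlinarith
  · have := (mul_pos_iff_of_pos_right hspos).mp hq
    linarith

lemma specRad_lt {n : Type*} [Fintype n] [DecidableEq n] (A : Matrix n n ℝ)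
    (h : ∀ μ : ℂ, Module.End.HasEigenvalue (Matrix.toLin' (A.map Complex.ofReal)) μ → ‖μ‖ < 1) :
    specRad A < 1 := by
  unfold specRad
  set S := {r : ℝ | ∃ μ : ℂ,
    Module.End.HasEigenvalue (Matrix.toLin' (A.map Complex.ofReal)) μ ∧ r = ‖μ‖} with hS
  have hfin : S.Finite := by
    have := (Module.End.finite_hasEigenvalue (Matrix.toLin' (A.map Complex.ofReal))).image
      (fun μ : ℂ => ‖μ‖)
    refine this.subset ?_
    rintro r ⟨μ, hμ, rfl⟩
    exact ⟨μ, hμ, rfl⟩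
  rcases S.eq_empty_or_nonempty with h0 | hne
  · rw [h0]; simp
  · obtain ⟨μ, hμ, hr⟩ := hne.csSup_mem hfin
    rw [hr]; exact h μ hμ

lemma charpoly_conj {V : Type*} [Fintype V] [DecidableEq V] (D E M : Matrix V V ℝ)
    (hED : E * D = 1) : (D * M * E).charpoly = M.charpoly := by
  rw [Matrix.charpoly_mul_comm, ← Matrix.mul_assoc, hED, Matrix.one_mul]

lemma charpoly_sim {V : Type*} [Fintype V] [DecidableEq V] (H : Matrix V V ℝ)
    (p : V → ℝ) (hpos : ∀ i, 0 < p i) :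
    (1 - (Matrix.diagonal p)⁻¹ * H).charpoly =
      (1 - Matrix.diagonal (fun i => (Real.sqrt (p i))⁻¹) * H *
          Matrix.diagonal (fun i => (Real.sqrt (p i))⁻¹)).charpoly := by
  generalize hD : Matrix.diagonal (fun i => (Real.sqrt (p i))⁻¹) = D
  obtain ⟨E, hE⟩ : ∃ E : Matrix V V ℝ, E = Matrix.diagonal (fun i => Real.sqrt (p i)) := ⟨_, rfl⟩
  have hsq : ∀ i, Real.sqrt (p i) ≠ 0 := fun i => (Real.sqrt_pos.mpr (hpos i)).ne'
  have hDE : D * E = 1 := by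
    rw [← hD, hE, Matrix.diagonal_mul_diagonal, ← Matrix.diagonal_one]
    congr 1; funext i; exact inv_mul_cancel₀ (hsq i)
  have hED : E * D = 1 := by
    rw [← hD, hE, Matrix.diagonal_mul_diagonal, ← Matrix.diagonal_one]
    congr 1; funext i; exact mul_inv_cancel₀ (hsq i)
  have hinv : (Matrix.diagonal p)⁻¹ = D * D := by
    apply Matrix.inv_eq_right_inv
    rw [← hD, Matrix.diagonal_mul_diagonal, Matrix.diagonal_mul_diagonal, ← Matrix.diagonal_one]
    congr 1; funext i
    rw [← mul_inv, Real.mul_self_sqrt (hpos i).le]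
    exact mul_inv_cancel₀ (hpos i).ne'
  rw [hinv]
  have : 1 - D * D * H = D * (1 - D * H * D) * E := by
    rw [Matrix.mul_sub, Matrix.sub_mul, Matrix.mul_one, hDE]
    simp only [Matrix.mul_assoc]
    rw [hDE, Matrix.mul_one]
  rw [this]
  exact charpoly_conj D E _ hED

/-- For a symmetric positive definite filter `H`, the spectral radius of
`I − (P_H^sym)⁻¹ H` is strictly less than `1`, and it equals the spectral radius of
`I − (P_H^sym)^{-1/2} H (P_H^sym)^{-1/2}`. -/
theorem specRad_psym_lt_one {V : Type*} [Fintype V] [DecidableEq V]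
    (G : SimpleGraph V) (hG : G.Connected)
    (H : Matrix V V ℝ) (hH : H.PosDef)
    (ω : ℕ) (hω : ∀ i j : V, ω < G.dist i j → H i j = 0) :
    specRad (1 - (psym G H ω)⁻¹ * H) < 1 ∧
      specRad (1 - (psym G H ω)⁻¹ * H) =
        specRad (1 - Matrix.diagonal (fun i => (Real.sqrt (psym G H ω i i))⁻¹) * H *
          Matrix.diagonal (fun i => (Real.sqrt (psym G H ω i i))⁻¹)) := by
  have hsum : ∀ i, ∑ j ∈ gBall G i ω, |H i j| = ∑ j, |H i j| := by
    intro i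
    apply Finset.sum_subset (Finset.subset_univ _)
    intro j _ hj
    have : ω < G.dist i j := by
      rw [SimpleGraph.dist_comm]
      simpa [gBall] using hj
    rw [hω i j this, abs_zero]
  obtain ⟨p, hp⟩ : ∃ p : V → ℝ, ∀ i, p i = ∑ j, |H i j| := ⟨_, fun _ => rfl⟩
  have hP : psym G H ω = Matrix.diagonal p := by
    unfold psym
    congr 1
    funext i
    rw [hsum i, hp i]
  have hpos : ∀ i, 0 < p i := by
    intro i
    have h1 : 0 < H i i := hH.diag_pos
    have h2 : |H i i| ≤ p i := by
      rw [hp]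
      exact Finset.single_le_sum (f := fun j => |H i j|) (fun j _ => abs_nonneg _) (Finset.mem_univ i)
    exact lt_of_lt_of_le (abs_pos.mpr h1.ne') h2
  rw [hP]
  simp only [Matrix.diagonal_apply_eq]
  refine ⟨specRad_lt _ fun μ hμ => eig_lt H hH p hp hpos μ hμ, ?_⟩
  exact specRad_congr _ _ (charpoly_sim H p hpos)
end

section
/- Let G be a connected simple graph on a finite vertex set V, let H be a symmetric positive definite real matrix indexed by V × V with geodesic-width ω(H), and let P_H^sym be the associated symmetric diagonal preconditioner. Given y ∈ ℝ^V and any initial vector x⁽⁰⁾ ∈ ℝ^V, define x⁽ᵐ⁾ = x⁽ᵐ⁻¹⁾ − (P_H^sym)^{-1} (H x⁽ᵐ⁻¹⁾ − y) for m ≥ 1. Then the error vectors satisfy x⁽ᵐ⁾ − H⁻¹y = (I − (P_H^sym)^{-1} H)(x⁽ᵐ⁻¹⁾ − H⁻¹y) for all m ≥ 1, and x⁽ᵐ⁾ converges to H⁻¹y as m → ∞. -/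
open Matrix BigOperators Finset Filter

lemma aux_quad_le {V : Type*} [Fintype V] (H : Matrix V V ℝ)
    (hs : ∀ i j, H i j = H j i) (d : V → ℝ) :
    d ⬝ᵥ (H *ᵥ d) ≤ ∑ i, (∑ j, |H i j|) * d i ^ 2 := by
  have h1 : d ⬝ᵥ (H *ᵥ d) = ∑ i, ∑ j, H i j * (d i * d j) := by
    simp only [dotProduct, mulVec, Finset.mul_sum]
    refine Finset.sum_congr rfl fun i _ => Finset.sum_congr rfl fun j _ => by ring
  have h2 : ∑ i, (∑ j, |H i j|) * d i ^ 2 = ∑ i, ∑ j, |H i j| * d i ^ 2 := by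
    simp only [Finset.sum_mul]
  have h3 : ∑ i, ∑ j, |H i j| * d i ^ 2 = ∑ i, ∑ j, |H i j| * d j ^ 2 := by
    rw [Finset.sum_comm]
    refine Finset.sum_congr rfl fun i _ => Finset.sum_congr rfl fun j _ => by rw [hs]
  have h4 : 2 * ∑ i, ∑ j, H i j * (d i * d j) ≤
      ∑ i, ∑ j, |H i j| * d i ^ 2 + ∑ i, ∑ j, |H i j| * d j ^ 2 := by
    rw [← Finset.sum_add_distrib, Finset.mul_sum]
    refine Finset.sum_le_sum fun i _ => ?_
    rw [← Finset.sum_add_distrib, Finset.mul_sum]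
    refine Finset.sum_le_sum fun j _ => ?_
    rcases abs_cases (H i j) with ⟨h, h'⟩ | ⟨h, h'⟩ <;> rw [h]
    · nlinarith [mul_nonneg h' (sq_nonneg (d i - d j))]
    · nlinarith [mul_nonneg (neg_nonneg.2 h'.le) (sq_nonneg (d i + d j))]
  rw [h1, h2]
  linarith

lemma aux_psym {V : Type*} [Fintype V] [DecidableEq V] (G : SimpleGraph V)
    (H : Matrix V V ℝ) (ω : ℕ) (hω : ∀ i j : V, ω < G.dist i j → H i j = 0) :
    psym G H ω = Matrix.diagonal (fun i => ∑ j, |H i j|) := by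
  unfold psym
  congr 1
  funext i
  refine Finset.sum_subset (Finset.subset_univ _) fun j _ hj => ?_
  rw [hω i j, abs_zero]
  simpa [gBall, SimpleGraph.dist_comm] using hj

/-- For the SPGDA iterates, the error vectors satisfy
`x⁽ᵐ⁾ − H⁻¹y = (I − (P_H^sym)⁻¹ H)(x⁽ᵐ⁻¹⁾ − H⁻¹y)`, and `x⁽ᵐ⁾` converges to `H⁻¹y`. -/
theorem spgda_error_recursion_tendsto {V : Type*} [Fintype V] [DecidableEq V]
    (G : SimpleGraph V) (hG : G.Connected)
    (H : Matrix V V ℝ) (hH : H.PosDef)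
    (ω : ℕ) (hω : ∀ i j : V, ω < G.dist i j → H i j = 0)
    (y : V → ℝ) (x : ℕ → V → ℝ)
    (hiter : ∀ m : ℕ, x (m + 1) = x m - (psym G H ω)⁻¹ *ᵥ (H *ᵥ x m - y)) :
    (∀ m : ℕ,
      x (m + 1) - H⁻¹ *ᵥ y =
        (1 - (psym G H ω)⁻¹ * H) *ᵥ (x m - H⁻¹ *ᵥ y)) ∧
      Filter.Tendsto x Filter.atTop (nhds (H⁻¹ *ᵥ y)) := by
  have hs : ∀ i j, H i j = H j i := fun i j => by
    simpa using (hH.isHermitian.apply j i)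
  have hu : IsUnit H.det := (Matrix.isUnit_iff_isUnit_det _).1 hH.isUnit
  have hHy : H *ᵥ (H⁻¹ *ᵥ y) = y := by
    rw [Matrix.mulVec_mulVec, Matrix.mul_nonsing_inv _ hu, Matrix.one_mulVec]
  have hrec : ∀ m : ℕ, x (m + 1) - H⁻¹ *ᵥ y =
      (1 - (psym G H ω)⁻¹ * H) *ᵥ (x m - H⁻¹ *ᵥ y) := by
    intro m
    rw [hiter, Matrix.sub_mulVec, Matrix.one_mulVec, ← Matrix.mulVec_mulVec,
      Matrix.mulVec_sub H, hHy]
    abel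
  refine ⟨hrec, ?_⟩
  set p : V → ℝ := fun i => ∑ j, |H i j| with hp
  have hppos : ∀ i, 0 < p i := fun i =>
    lt_of_lt_of_le (abs_pos.2 (hH.diag_pos (i := i)).ne')
      (Finset.single_le_sum (f := fun j => |H i j|) (fun j _ => abs_nonneg _) (Finset.mem_univ i))
  have hpinv : (psym G H ω)⁻¹ = Matrix.diagonal (fun i => (p i)⁻¹) := by
    rw [aux_psym G H ω hω]
    refine Matrix.inv_eq_right_inv ?_
    rw [Matrix.diagonal_mul_diagonal, ← Matrix.diagonal_one]
    congr 1
    funext i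
    exact mul_inv_cancel₀ (hppos i).ne'
  set e : ℕ → V → ℝ := fun m => x m - H⁻¹ *ᵥ y with he
  set r : ℕ → V → ℝ := fun m => H *ᵥ e m with hr
  set d : ℕ → V → ℝ := fun m i => (p i)⁻¹ * r m i with hd
  have hstep : ∀ m, e (m + 1) = e m - d m := by
    intro m
    have := hrec m
    rw [Matrix.sub_mulVec, Matrix.one_mulVec, ← Matrix.mulVec_mulVec, hpinv] at this
    refine this.trans ?_
    congr 1
    funext i
    rw [Matrix.mulVec_diagonal]
  set E : ℕ → ℝ := fun m => e m ⬝ᵥ (H *ᵥ e m) with hE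
  set Q : ℕ → ℝ := fun m => ∑ i, (p i)⁻¹ * r m i ^ 2 with hQ
  have hQnn : ∀ m, 0 ≤ Q m := fun m => Finset.sum_nonneg fun i _ =>
    mul_nonneg (inv_nonneg.2 (hppos i).le) (sq_nonneg _)
  have hEdec : ∀ m, Q m ≤ E m - E (m + 1) := by
    intro m
    have h1 : d m ⬝ᵥ (H *ᵥ e m) = Q m := by
      simp only [hQ, hd, hr, dotProduct]
      refine Finset.sum_congr rfl fun i _ => by ring
    have h2 : e m ⬝ᵥ (H *ᵥ d m) = Q m := by
      rw [← h1, Matrix.dotProduct_mulVec, dotProduct_comm]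
      congr 1
      rw [← Matrix.mulVec_transpose]
      congr 1
      ext i j
      exact hs j i
    have h3 : d m ⬝ᵥ (H *ᵥ d m) ≤ Q m := by
      refine (aux_quad_le H hs (d m)).trans (le_of_eq ?_)
      refine Finset.sum_congr rfl fun i _ => ?_
      change p i * ((p i)⁻¹ * r m i) ^ 2 = _
      have := (hppos i).ne'
      field_simp
    have h4 : E (m + 1) = E m - 2 * Q m + d m ⬝ᵥ (H *ᵥ d m) := by
      simp only [hE]
      rw [hstep, Matrix.mulVec_sub, sub_dotProduct, dotProduct_sub, dotProduct_sub, h1, h2]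
      ring
    linarith
  have hEnn : ∀ m, 0 ≤ E m := fun m => by
    simpa using hH.posSemidef.dotProduct_mulVec_nonneg (e m)
  have hanti : Antitone E := antitone_nat_of_succ_le fun m => by
    linarith [hEdec m, hQnn m]
  have hElim := tendsto_atTop_ciInf hanti ⟨0, by rintro _ ⟨m, rfl⟩; exact hEnn m⟩
  have hdiff := hElim.sub (hElim.comp (tendsto_add_atTop_nat 1))
  rw [sub_self] at hdiff
  have hQ0 : Tendsto Q atTop (nhds 0) := squeeze_zero hQnn hEdec hdiff
  have hr0 : Tendsto r atTop (nhds 0) := by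
    rw [tendsto_pi_nhds]
    intro i
    have hsq : Tendsto (fun m => r m i ^ 2) atTop (nhds 0) := by
      have hb := hQ0.const_mul (p i)
      rw [mul_zero] at hb
      refine squeeze_zero (fun m => sq_nonneg _) (fun m => ?_) hb
      have hle : (p i)⁻¹ * r m i ^ 2 ≤ Q m :=
        Finset.single_le_sum (f := fun i => (p i)⁻¹ * r m i ^ 2)
          (fun j _ => mul_nonneg (inv_nonneg.2 (hppos j).le) (sq_nonneg _)) (Finset.mem_univ i)
      have := mul_le_mul_of_nonneg_left hle (hppos i).le
      rwa [mul_inv_cancel_left₀ (hppos i).ne'] at this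
    have hab := hsq.sqrt
    simp only [Real.sqrt_sq_eq_abs, Real.sqrt_zero] at hab
    exact (tendsto_zero_iff_abs_tendsto_zero _).2 hab
  have hc : Continuous fun v : V → ℝ => H⁻¹ *ᵥ y + H⁻¹ *ᵥ v := by fun_prop
  have hfin := (hc.tendsto 0).comp hr0
  rw [Matrix.mulVec_zero, add_zero] at hfin
  refine hfin.congr fun m => ?_
  simp only [Function.comp, hr, he]
  rw [Matrix.mulVec_mulVec, Matrix.nonsing_inv_mul _ hu, Matrix.one_mulVec]
  abel
end
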